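/- Let p ≥ 3 and let Γ = {α^(1), …, α^(k)} be a set of k distinct minimal overlapping permutations in S_p, each starting with 1, such that α^(i) and α^(j) are mutually minimal overlapping for all 1 ≤ i < j ≤ k. For each i let s_i be the last element of α^(i), and assume 2 ≤ s_i < p. Then IU_{Γ,1}(q,z) = −z, and for all n ≥ 2, IU_{Γ,n}(q,z) = (1−z)·IU_{Γ,n−1}(q,z) − Σ_{i=1}^{k} z^{des(α^(i))} q^{inv(α^(i))} [n−s_i choose p−s_i]_q · IU_{Γ,n−p+1}(q,z), where [a choose b]_q is taken to be 0 whenever a < b. -/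

import Mathlib

open scoped Classical

noncomputable section

namespace CWilf

/-- The number of descents of a permutation of `{0, …, n-1}` (0-based). -/
def des {n : ℕ} (σ : Equiv.Perm (Fin n)) : ℕ :=
  (Finset.univ.filter fun i : Fin n =>
    ∃ h : (i : ℕ) + 1 < n, σ ⟨(i : ℕ) + 1, h⟩ < σ i).card

/-- The number of inversions of `σ`. -/
def inv {n : ℕ} (σ : Equiv.Perm (Fin n)) : ℕ :=
  (Finset.univ.filter fun q : Fin n × Fin n => q.1 < q.2 ∧ σ q.2 < σ q.1).card

/-- The number of coinversions of `σ`. -/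
def coinv {n : ℕ} (σ : Equiv.Perm (Fin n)) : ℕ :=
  (Finset.univ.filter fun q : Fin n × Fin n => q.1 < q.2 ∧ σ q.1 < σ q.2).card

/-- The number of left-to-right minima of `σ`. -/
def LRmin {n : ℕ} (σ : Equiv.Perm (Fin n)) : ℕ :=
  (Finset.univ.filter fun j : Fin n => ∀ i : Fin n, i < j → σ j < σ i).card

/-- There is a `τ`-match of `σ` starting at (0-based) position `i`, i.e.
`red(σ_i σ_{i+1} ⋯ σ_{i+j-1}) = τ`. -/
def MatchAt {j n : ℕ} (τ : Equiv.Perm (Fin j)) (σ : Equiv.Perm (Fin n)) (i : ℕ) : Prop :=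
  ∃ h : i + j ≤ n, ∀ a b : Fin j,
    τ a < τ b ↔
      σ ⟨i + (a : ℕ), by have := a.isLt; omega⟩ < σ ⟨i + (b : ℕ), by have := b.isLt; omega⟩

/-- The number of `τ`-matches of `σ`. -/
def mch {j n : ℕ} (τ : Equiv.Perm (Fin j)) (σ : Equiv.Perm (Fin n)) : ℕ :=
  ((Finset.range n).filter fun i => MatchAt τ σ i).card

/-- `τ` is minimal overlapping: the smallest `n` such that some `σ ∈ S_n` has
exactly two `τ`-matches is `2j - 1`. -/
def MinOverlapping {j : ℕ} (τ : Equiv.Perm (Fin j)) : Prop :=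
  IsLeast {n : ℕ | ∃ σ : Equiv.Perm (Fin n), mch τ σ = 2} (2 * j - 1)

/-- `α` and `β` are mutually minimal overlapping. -/
def MutuallyMinOverlapping {j : ℕ} (α β : Equiv.Perm (Fin j)) : Prop :=
  MinOverlapping α ∧ MinOverlapping β ∧
    IsLeast {n : ℕ | ∃ σ : Equiv.Perm (Fin n), 1 ≤ mch α σ ∧ 1 ≤ mch β σ} (2 * j - 1)

/-- The set of permutations of `S_n` with no `τ`-match. -/
def NM (n : ℕ) {j : ℕ} (τ : Equiv.Perm (Fin j)) : Finset (Equiv.Perm (Fin n)) :=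
  Finset.univ.filter fun σ => mch τ σ = 0

/-- The `p,q`-analogue `[n]_{p,q} = p^{n-1} + p^{n-2}q + ⋯ + q^{n-1}`. -/
def pqInt {K : Type} [CommSemiring K] (p q : K) (n : ℕ) : K :=
  ∑ i ∈ Finset.range n, p ^ (n - 1 - i) * q ^ i

/-- The `p,q`-factorial `[n]_{p,q}!`. -/
def pqFact {K : Type} [CommSemiring K] (p q : K) : ℕ → K
  | 0 => 1
  | n + 1 => pqFact p q n * pqInt p q (n + 1)

/-- The `p,q`-binomial coefficient, taken to be `0` when `k > n`. -/
def pqBinom {K : Type} [Field K] (p q : K) (n k : ℕ) : K :=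
  if k ≤ n then pqFact p q n / (pqFact p q k * pqFact p q (n - k)) else 0

/-- The `q`-analogue `[n]_q = 1 + q + ⋯ + q^{n-1}`. -/
def qInt {K : Type} [CommSemiring K] (q : K) (n : ℕ) : K :=
  ∑ i ∈ Finset.range n, q ^ i

/-- The `q`-factorial `[n]_q!`. -/
def qFact {K : Type} [CommSemiring K] (q : K) : ℕ → K
  | 0 => 1
  | n + 1 => qFact q n * qInt q (n + 1)

/-- The `q`-binomial coefficient, taken to be `0` when `k > n`. -/
def qBinom {K : Type} [Field K] (q : K) (n k : ℕ) : K :=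
  if k ≤ n then qFact q n / (qFact q k * qFact q (n - k)) else 0

/-- `mp_{τ, n(j-1)+1}(p,q)`, the generating polynomial
`Σ_{σ ∈ MP_{τ,n(j-1)+1}} q^{inv σ} p^{coinv σ}` over maximum packings for `τ`. -/
def mpSum {j : ℕ} (τ : Equiv.Perm (Fin j)) (n : ℕ) {K : Type} [CommSemiring K] (p q : K) : K :=
  ∑ σ ∈ Finset.univ.filter (fun σ : Equiv.Perm (Fin (n * (j - 1) + 1)) => mch τ σ = n),
    q ^ inv σ * p ^ coinv σ

/-- The field `ℚ(p,q)` of rational functions in two variables. -/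
abbrev K2 : Type := FractionRing (MvPolynomial (Fin 2) ℚ)

/-- The variable `p` in `ℚ(p,q)`. -/
def pW : K2 := algebraMap (MvPolynomial (Fin 2) ℚ) K2 (MvPolynomial.X 0)
/-- The variable `q` in `ℚ(p,q)`. -/
def qW : K2 := algebraMap (MvPolynomial (Fin 2) ℚ) K2 (MvPolynomial.X 1)

/-- `INM_{Γ,n}(q,z)` for a family `Γ = {A 0, …, A (k-1)}` of permutations,
with `INM_{Γ,0}(q,z) = 1` and
`INM_{Γ,n}(q,z) = Σ_{σ∈NM_n(Γ)} z^{des σ + 1} q^{inv σ}` for `n ≥ 1`, where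
`NM_n(Γ)` is the set of `σ ∈ S_n` with no `A i`-match for any `i`. -/
def INMF {p k : ℕ} (A : Fin k → Equiv.Perm (Fin p)) (n : ℕ) {K : Type} [CommSemiring K]
    (q z : K) : K :=
  if n = 0 then 1
  else ∑ σ ∈ Finset.univ.filter (fun σ : Equiv.Perm (Fin n) => ∀ i : Fin k, mch (A i) σ = 0),
    z ^ (des σ + 1) * q ^ inv σ

/-- The number of descents of a list. -/
def listDes : List ℕ → ℕ
  | [] => 0
  | [_] => 0
  | x :: y :: t => (if y < x then 1 else 0) + listDes (y :: t)

/-- The number of inversions of a list. -/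
def listInv : List ℕ → ℕ
  | [] => 0
  | x :: t => t.countP (· < x) + listInv t

/-- The first `p` entries of `l` are in the same relative order as `τ`. -/
def PrefixMatch {p : ℕ} (τ : Equiv.Perm (Fin p)) (l : List ℕ) : Prop :=
  ∃ h : p ≤ l.length, ∀ a b : Fin p,
    τ a < τ b ↔ l[(a : ℕ)]'(a.2.trans_le h) < l[(b : ℕ)]'(b.2.trans_le h)

/-- No window of `l` is in the same relative order as some `A i`. -/
def Avoids {p k : ℕ} (A : Fin k → Equiv.Perm (Fin p)) (l : List ℕ) : Prop :=
  ∀ (d : ℕ) (i : Fin k), ¬ PrefixMatch (A i) (l.drop d)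

/-- The contribution of a list to `INMF`, apart from the power counting inversions. -/
def avoidWeight {p k : ℕ} (A : Fin k → Equiv.Perm (Fin p)) {K : Type} [Field K] (z : K)
    (l : List ℕ) : K :=
  if l = [] then 1 else if Avoids A l then z ^ (listDes l + 1) else 0

/-- The total weight of the ways to cover a list by a chain of links, consecutive links sharing
one entry: an ascent between adjacent entries is a link of weight `1 - z`, and a match of `A i`
is a link of weight `-z ^ des (A i)`. -/
def blockWeight {p k : ℕ} (A : Fin k → Equiv.Perm (Fin p)) {K : Type} [Field K] (z : K) :
    List ℕ → K
  | [] => 0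
  | [_] => 1
  | x :: y :: t =>
    (if x < y then (1 - z) * blockWeight A z (y :: t) else 0) -
      ∑ i, if PrefixMatch (A i) (x :: y :: t) then
        z ^ des (A i) * blockWeight A z ((y :: t).drop (p - 2)) else 0
  termination_by l => l.length
  decreasing_by all_goals simp; try omega

/-- The orderings of `X`. -/
def orderings (X : Finset ℕ) : Finset (List ℕ) := X.val.lists.toFinset

/-- The sum of `q ^ listInv l * F l` over all orderings `l` of `X`. -/
def orderingSum {K : Type} [Field K] (q : K) (F : List ℕ → K) (X : Finset ℕ) : K :=
  ∑ l ∈ orderings X, q ^ listInv l * F l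

/-- `F l` depends only on the relative order of the entries of `l`. -/
def OrderInvariant {K : Type} (F : List ℕ → K) : Prop :=
  ∀ (f : ℕ → ℕ) (l : List ℕ), StrictMonoOn f {x | x ∈ l} → F (l.map f) = F l

/-- The number of pairs in `S × T` whose first entry is the larger one. -/
def crossInv (S T : Finset ℕ) : ℕ :=
  ∑ x ∈ S, (T.filter (· < x)).card

section PrefixMatch

variable {p : ℕ} {τ : Equiv.Perm (Fin p)}

lemma prefixMatch_take (l : List ℕ) (m : ℕ) :
    PrefixMatch τ (l.take m) ↔ p ≤ m ∧ PrefixMatch τ l := by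
  constructor
  · rintro ⟨h, H⟩
    have h' := h
    simp only [List.length_take, le_min_iff] at h'
    refine ⟨h'.1, h'.2, fun a b => ?_⟩
    simpa using H a b
  · rintro ⟨hm, h, H⟩
    refine ⟨by simp [hm, h], fun a b => ?_⟩
    simpa using H a b

lemma prefixMatch_map {f : ℕ → ℕ} {l : List ℕ} (hf : StrictMonoOn f {x | x ∈ l}) :
    PrefixMatch τ (l.map f) ↔ PrefixMatch τ l := by
  constructor
  · rintro ⟨h, H⟩
    refine ⟨by simpa using h, fun a b => ?_⟩
    rw [H a b, List.getElem_map, List.getElem_map,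
      hf.lt_iff_lt (by simp) (by simp)]
  · rintro ⟨h, H⟩
    refine ⟨by simpa using h, fun a b => ?_⟩
    rw [H a b, List.getElem_map, List.getElem_map,
      hf.lt_iff_lt (by simp) (by simp)]

lemma matchAt_iff (hp : 0 < p) {n : ℕ} {w : List ℕ} (hw : w.length = n)
    {σ : Equiv.Perm (Fin n)}
    (hσ : ∀ a b : Fin n, σ a < σ b ↔ w[(a : ℕ)]'(hw ▸ a.2) < w[(b : ℕ)]'(hw ▸ b.2)) (d : ℕ) :
    MatchAt τ σ d ↔ PrefixMatch τ (w.drop d) := by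
  constructor
  · rintro ⟨h, H⟩
    refine ⟨by simp; omega, fun a b => ?_⟩
    rw [H a b, hσ]
    simp
  · rintro ⟨h, H⟩
    simp only [List.length_drop] at h
    refine ⟨by omega, fun a b => ?_⟩
    rw [H a b, hσ]
    simp

lemma mch_eq_card (hp : 0 < p) {n : ℕ} {w : List ℕ} (hw : w.length = n)
    {σ : Equiv.Perm (Fin n)}
    (hσ : ∀ a b : Fin n, σ a < σ b ↔ w[(a : ℕ)]'(hw ▸ a.2) < w[(b : ℕ)]'(hw ▸ b.2)) :
    mch τ σ = ((Finset.range n).filter fun d => PrefixMatch τ (w.drop d)).card := by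
  simp only [mch, matchAt_iff hp hw hσ]

lemma exists_perm_of_nodup {w : List ℕ} (hw : w.Nodup) :
    ∃ σ : Equiv.Perm (Fin w.length), ∀ a b, σ a < σ b ↔ w[(a : ℕ)] < w[(b : ℕ)] := by
  have hs : StrictMono (w.get ∘ Tuple.sort w.get) :=
    (Tuple.monotone_sort w.get).strictMono_of_injective
      ((List.nodup_iff_injective_get.1 hw).comp (Tuple.sort w.get).injective)
  refine ⟨(Tuple.sort w.get)⁻¹, fun a b => ?_⟩
  rw [← hs.lt_iff_lt]
  simp

lemma not_prefixMatch_drop (hτ : MinOverlapping τ) {l : List ℕ} (hl : l.Nodup)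
    (h0 : PrefixMatch τ l) {d : ℕ} (hd : 1 ≤ d) (hdp : d + 2 ≤ p) :
    ¬ PrefixMatch τ (l.drop d) := by
  induction d using Nat.strong_induction_on with
  | _ d ih =>
    intro h1
    have hlen : p + d ≤ l.length := by
      have := h1.1
      simp only [List.length_drop] at this
      omega
    obtain ⟨σ, hσ⟩ := exists_perm_of_nodup (hl.sublist (List.take_sublist (p + d) l))
    have hm := mch_eq_card (τ := τ) (by omega) rfl hσ
    have hw : (l.take (p + d)).length = p + d := by simpa using hlen
    have : ((Finset.range (l.take (p + d)).length).filter fun e =>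
        PrefixMatch τ ((l.take (p + d)).drop e)) = {0, d} := by
      ext e
      simp only [Finset.mem_filter, Finset.mem_range, hw, Finset.mem_insert,
        Finset.mem_singleton, List.drop_take, prefixMatch_take]
      constructor
      · rintro ⟨-, he, hm⟩
        by_contra! hne
        exact ih e (by omega) (by omega) (by omega) hm
      · rintro (rfl | rfl)
        · exact ⟨by omega, by omega, by simpa using h0⟩
        · exact ⟨by omega, by omega, h1⟩
    rw [this, Finset.card_pair (by omega)] at hm
    have := hτ.2 ⟨σ, hm⟩
    omega

lemma not_prefixMatch_drop_of_mutually {τ' : Equiv.Perm (Fin p)}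
    (hτ : IsLeast {n : ℕ | ∃ σ : Equiv.Perm (Fin n), 1 ≤ mch τ σ ∧ 1 ≤ mch τ' σ} (2 * p - 1))
    {l : List ℕ} (hl : l.Nodup) {d d' : ℕ} (hd : d + 2 ≤ p) (hd' : d' + 2 ≤ p)
    (hdd : d = 0 ∨ d' = 0) (h : PrefixMatch τ (l.drop d)) : ¬ PrefixMatch τ' (l.drop d') := by
  intro h'
  have hlen : p + d + d' ≤ l.length := by
    have h1 := h.1
    have h2 := h'.1
    simp only [List.length_drop] at h1 h2
    omega
  obtain ⟨σ, hσ⟩ := exists_perm_of_nodup (hl.sublist (List.take_sublist (p + d + d') l))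
  have hw : (l.take (p + d + d')).length = p + d + d' := by simpa using hlen
  have := hτ.2 ⟨σ, by
    rw [mch_eq_card (by omega) rfl hσ, Nat.one_le_iff_ne_zero, Finset.card_ne_zero]
    refine ⟨d, ?_⟩
    simp only [Finset.mem_filter, Finset.mem_range, hw, List.drop_take, prefixMatch_take]
    exact ⟨by omega, by omega, h⟩, by
    rw [mch_eq_card (by omega) rfl hσ, Nat.one_le_iff_ne_zero, Finset.card_ne_zero]
    refine ⟨d', ?_⟩
    simp only [Finset.mem_filter, Finset.mem_range, hw, List.drop_take, prefixMatch_take]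
    exact ⟨by omega, by omega, h'⟩⟩
  omega

end PrefixMatch

lemma listDes_ofFn {n : ℕ} (f : Fin n → ℕ) :
    listDes (List.ofFn f) =
      (Finset.univ.filter fun i : Fin n => ∃ h : (i : ℕ) + 1 < n, f ⟨i + 1, h⟩ < f i).card := by
  induction n with
  | zero => simp [listDes]
  | succ n ih =>
    cases n with
    | zero =>
      symm
      rw [List.ofFn_succ, List.ofFn_zero, listDes, Finset.card_eq_zero,
        Finset.filter_eq_empty_iff]
      rintro i - ⟨h, -⟩
      omega
    | succ n =>
      have h := ih (fun i => f i.succ)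
      rw [List.ofFn_succ] at h
      rw [Finset.card_filter, Fin.sum_univ_succ, List.ofFn_succ, List.ofFn_succ, listDes, h,
        Finset.card_filter]
      exact congrArg₂ _ (if_congr ⟨fun h => ⟨by simp, h⟩, fun ⟨_, h⟩ => h⟩ rfl rfl)
        (Finset.sum_congr rfl fun i _ => if_congr
          ⟨fun ⟨h, H⟩ => ⟨by simpa using h, H⟩, fun ⟨h, H⟩ => ⟨by simpa using h, H⟩⟩ rfl rfl)

lemma listInv_ofFn {n : ℕ} (f : Fin n → ℕ) :
    listInv (List.ofFn f) =
      (Finset.univ.filter fun q : Fin n × Fin n => q.1 < q.2 ∧ f q.2 < f q.1).card := by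
  induction n with
  | zero => simp [listInv]
  | succ n ih =>
    have hc : ∀ (m : ℕ) (g : Fin m → ℕ) (x : ℕ),
        (List.ofFn g).countP (· < x) = ∑ i, if g i < x then 1 else 0 := by
      intro m g x
      induction m with
      | zero => simp
      | succ m ih =>
        rw [List.ofFn_succ, List.countP_cons, ih, Fin.sum_univ_succ, add_comm]
        simp
    rw [Finset.card_filter, Fintype.sum_prod_type, Fin.sum_univ_succ, List.ofFn_succ, listInv, hc,
      ih, Finset.card_filter, Fintype.sum_prod_type, Fin.sum_univ_succ]
    simp only [Fin.sum_univ_succ, Fin.succ_lt_succ_iff, Fin.succ_pos, true_and, lt_irrefl,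
      Fin.not_lt_zero, false_and, if_false, zero_add]

lemma mem_orderings {X : Finset ℕ} {l : List ℕ} :
    l ∈ orderings X ↔ l.Nodup ∧ l.toFinset = X := by
  rw [orderings, Multiset.mem_toFinset, Multiset.mem_lists_iff]
  constructor
  · intro h
    have hl : l.Nodup := by
      rw [← Multiset.coe_nodup]
      exact Eq.subst (motive := Multiset.Nodup) h X.nodup
    exact ⟨hl, Finset.val_injective (by rw [h, List.toFinset_val, hl.dedup]; rfl)⟩
  · rintro ⟨hl, rfl⟩
    rw [List.toFinset_val, hl.dedup]
    rfl

lemma length_of_mem_orderings {X : Finset ℕ} {l : List ℕ} (h : l ∈ orderings X) :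
    l.length = X.card := by
  obtain ⟨hl, rfl⟩ := mem_orderings.1 h
  exact (List.toFinset_card_of_nodup hl).symm

lemma listInv_append (u v : List ℕ) :
    listInv (u ++ v) =
      listInv u + listInv v + (u.map fun x => v.countP (· < x)).sum := by
  induction u with
  | nil => simp [listInv]
  | cons x u ih =>
    simp only [List.cons_append, listInv, ih, List.countP_append, List.map_cons, List.sum_cons]
    omega

lemma listInv_append_of_mem_orderings {S T : Finset ℕ} {u v : List ℕ} (hu : u ∈ orderings S)
    (hv : v ∈ orderings T) :
    listInv (u ++ v) = listInv u + listInv v + crossInv S T := by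
  obtain ⟨hu', rfl⟩ := mem_orderings.1 hu
  obtain ⟨hv', rfl⟩ := mem_orderings.1 hv
  rw [listInv_append, crossInv, List.sum_toFinset _ hu']
  congr 3
  ext x
  rw [List.countP_eq_length_filter, ← List.toFinset_card_of_nodup (hv'.filter _),
    List.toFinset_filter]
  simp

lemma sum_orderings_append {M : Type} [AddCommMonoid M] {X : Finset ℕ} {m : ℕ}
    (hm : m ≤ X.card) (F : List ℕ → M) :
    ∑ l ∈ orderings X, F l =
      ∑ S ∈ Finset.powersetCard m X, ∑ u ∈ orderings S, ∑ v ∈ orderings (X \ S), F (u ++ v) := by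
  simp only [← Finset.sum_product', Finset.sum_sigma']
  symm
  refine Finset.sum_nbij' (fun x => x.2.1 ++ x.2.2)
    (fun l => ⟨(l.take m).toFinset, (l.take m, l.drop m)⟩) ?_ ?_ ?_ ?_ (fun _ _ => rfl)
  · rintro ⟨S, u, v⟩ h
    simp only [Finset.mem_sigma, Finset.mem_powersetCard, Finset.mem_product, mem_orderings] at h ⊢
    obtain ⟨⟨hS, hc⟩, ⟨hu, rfl⟩, hv, hvX⟩ := h
    refine ⟨List.nodup_append'.2 ⟨hu, hv, ?_⟩, ?_⟩
    · intro x hx hx'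
      have : x ∈ v.toFinset := by simpa using hx'
      rw [hvX] at this
      simp_all
    · rw [List.toFinset_append, hvX, Finset.union_sdiff_of_subset hS]
  · intro l h
    have hlen := length_of_mem_orderings h
    obtain ⟨hl, rfl⟩ := mem_orderings.1 h
    have ht := hl.sublist (List.take_sublist m l)
    simp only [Finset.mem_sigma, Finset.mem_powersetCard, Finset.mem_product, mem_orderings]
    refine ⟨⟨fun x hx => ?_, ?_⟩, ⟨ht, trivial⟩, hl.sublist (List.drop_sublist m l), ?_⟩
    · simp only [List.mem_toFinset] at hx ⊢
      exact List.mem_of_mem_take hx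
    · rw [List.toFinset_card_of_nodup ht]
      simp; omega
    · have hd := List.disjoint_take_drop hl (le_refl m)
      ext x
      have : x ∈ l ↔ x ∈ l.take m ∨ x ∈ l.drop m := by
        rw [← List.mem_append, List.take_append_drop]
      simp only [List.mem_toFinset, Finset.mem_sdiff, this]
      have := @hd x
      tauto
  · rintro ⟨S, u, v⟩ h
    simp only [Finset.mem_sigma, Finset.mem_powersetCard, Finset.mem_product] at h
    have hlen := length_of_mem_orderings h.2.1
    obtain ⟨hu, rfl⟩ := mem_orderings.1 h.2.1
    have : m = u.length := by rw [hlen, h.1.2]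
    simp [this]
  · intro l _
    simp

lemma listInv_map {f : ℕ → ℕ} {l : List ℕ} (hf : StrictMonoOn f {x | x ∈ l}) :
    listInv (l.map f) = listInv l := by
  induction l with
  | nil => rfl
  | cons x t ih =>
    rw [List.map_cons, listInv, listInv, ih (hf.mono fun y hy => by simp_all), List.countP_map]
    congr 1
    refine List.countP_congr fun y hy => ?_
    simp [hf.lt_iff_lt (show y ∈ {z | z ∈ x :: t} by simp [hy])
      (show x ∈ {z | z ∈ x :: t} by simp)]

lemma listDes_map {f : ℕ → ℕ} : ∀ {l : List ℕ}, StrictMonoOn f {x | x ∈ l} →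
    listDes (l.map f) = listDes l
  | [], _ => rfl
  | [_], _ => rfl
  | x :: y :: t, hf => by
    have := listDes_map (f := f) (l := y :: t) (hf.mono fun y hy => by simp_all)
    rw [List.map_cons] at this
    rw [List.map_cons, List.map_cons, listDes, listDes, this]
    simp only [hf.lt_iff_lt (show y ∈ {z | z ∈ x :: y :: t} by simp)
      (show x ∈ {z | z ∈ x :: y :: t} by simp)]

lemma map_mem_orderings {f : ℕ → ℕ} {X : Finset ℕ} (hf : Set.InjOn f X) {l : List ℕ}
    (hl : l ∈ orderings X) : l.map f ∈ orderings (X.image f) := by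
  obtain ⟨hn, rfl⟩ := mem_orderings.1 hl
  refine mem_orderings.2 ⟨hn.map_on ?_, ?_⟩
  · intro x hx y hy
    exact hf (by simpa using hx) (by simpa using hy)
  · ext
    simp

section OrderingSum

variable {K : Type} [Field K] {q : K} {F : List ℕ → K}

lemma orderingSum_image (hF : OrderInvariant F) {f : ℕ → ℕ} {X : Finset ℕ}
    (hf : StrictMonoOn f X) : orderingSum q F (X.image f) = orderingSum q F X := by
  have hg : Set.LeftInvOn (Function.invFunOn f X) f X := hf.injOn.leftInvOn_invFunOn
  have hgX : (X.image f).image (Function.invFunOn f X) = X := by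
    rw [Finset.image_image]
    exact (Finset.image_congr fun x hx => hg hx).trans Finset.image_id
  symm
  refine Finset.sum_nbij' (List.map f) (List.map (Function.invFunOn f X))
    (fun l hl => map_mem_orderings hf.injOn hl) (fun l hl => ?_) ?_ ?_ ?_
  · have hi : Set.InjOn (Function.invFunOn f X) (X.image f : Finset ℕ) := by
      rw [Finset.coe_image]
      exact Function.invFunOn_injOn_image f X
    have := map_mem_orderings hi hl
    rwa [hgX] at this
  · intro l hl
    rw [List.map_map]
    refine (List.map_congr_left fun x hx => ?_).trans (List.map_id l)
    exact hg (by simpa [← (mem_orderings.1 hl).2] using hx)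
  · intro l hl
    rw [List.map_map]
    refine (List.map_congr_left fun x hx => ?_).trans (List.map_id l)
    obtain ⟨y, hy, rfl⟩ : ∃ y ∈ X, f y = x := by
      rw [← Finset.mem_image, ← (mem_orderings.1 hl).2]
      simpa using hx
    exact congrArg f (hg hy)
  · intro l hl
    have : StrictMonoOn f {x | x ∈ l} :=
      hf.mono fun x hx => by simpa [← (mem_orderings.1 hl).2] using hx
    rw [listInv_map this, hF f l this]

lemma orderingSum_eq_of_card (hF : OrderInvariant F) {X Y : Finset ℕ} (h : X.card = Y.card) :
    orderingSum q F X = orderingSum q F Y := by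
  let e := (X.orderIsoOfFin rfl).symm.trans (Y.orderIsoOfFin h.symm)
  let f : ℕ → ℕ := fun x => if h : x ∈ X then e ⟨x, h⟩ else 0
  have hf : StrictMonoOn f X := by
    intro x hx y hy hxy
    have hx : x ∈ X := hx
    have hy : y ∈ X := hy
    simp only [f, hx, hy, dif_pos]
    exact e.strictMono (Subtype.mk_lt_mk.2 hxy)
  have hY : X.image f = Y := by
    refine Finset.eq_of_subset_of_card_le (fun y hy => ?_) ?_
    · obtain ⟨x, hx, rfl⟩ := Finset.mem_image.1 hy
      simp [f, hx]
    · rw [Finset.card_image_of_injOn hf.injOn, h]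
  rw [← hY, orderingSum_image hF hf]

lemma orderingSum_insert {x : ℕ} {Y : Finset ℕ} (hx : ∀ y ∈ Y, x < y)
    (hF : ∀ l : List ℕ, l ∈ orderings (insert x Y) → F l ≠ 0 → ∃ v, l = x :: v) :
    orderingSum q F (insert x Y) = orderingSum q (fun v => F (x :: v)) Y := by
  have hxY : x ∉ Y := fun h => (hx x h).false
  symm
  refine Finset.sum_of_injOn (fun v => x :: v) (by simp) ?_ ?_ ?_
  · intro v hv
    obtain ⟨hn, rfl⟩ := mem_orderings.1 (Finset.mem_coe.1 hv)
    exact Finset.mem_coe.2 (mem_orderings.2 ⟨List.nodup_cons.2 ⟨by simpa using hxY, hn⟩, by simp⟩)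
  · intro l hl hl'
    by_contra h
    obtain ⟨v, rfl⟩ := hF l hl (fun h0 => h (by simp [h0]))
    refine hl' ⟨v, ?_, rfl⟩
    obtain ⟨hn, he⟩ := mem_orderings.1 hl
    rw [List.nodup_cons] at hn
    refine Finset.mem_coe.2 (mem_orderings.2 ⟨hn.2, ?_⟩)
    rw [List.toFinset_cons] at he
    rw [← Finset.erase_insert hxY, ← he, Finset.erase_insert (by simpa using hn.1)]
  · intro v hv
    have : v.countP (· < x) = 0 := by
      obtain ⟨hv, rfl⟩ := mem_orderings.1 hv
      simpa [List.countP_eq_zero] using fun y hy => (hx y (by simpa using hy)).le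
    simp [listInv, this]

end OrderingSum

section QBinomial

variable {K : Type} [Field K] {q : K}

lemma qFact_ne_zero (hq : ∀ n, qInt q (n + 1) ≠ 0) (n : ℕ) : qFact q n ≠ 0 := by
  induction n with
  | zero => simp [qFact]
  | succ n ih => exact mul_ne_zero ih (hq n)

lemma qBinom_self (hq : ∀ n, qInt q (n + 1) ≠ 0) (n : ℕ) : qBinom q n n = 1 := by
  simp [qBinom, qFact, qFact_ne_zero hq]

lemma qBinom_zero_right (hq : ∀ n, qInt q (n + 1) ≠ 0) (n : ℕ) : qBinom q n 0 = 1 := by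
  simp [qBinom, qFact, qFact_ne_zero hq]

lemma qBinom_succ_succ (hq : ∀ n, qInt q (n + 1) ≠ 0) (n k : ℕ) :
    qBinom q (n + 1) (k + 1) = qBinom q n (k + 1) + q ^ (n - k) * qBinom q n k := by
  rcases lt_trichotomy n k with h | rfl | h
  · rw [qBinom, qBinom, qBinom, if_neg (by omega), if_neg (by omega), if_neg (by omega)]
    simp
  · rw [qBinom_self hq, qBinom_self hq, qBinom, if_neg (by omega)]
    simp
  · obtain ⟨d, rfl⟩ := Nat.exists_eq_add_of_lt h
    have hsum : qInt q (k + d + 1 + 1) = qInt q (d + 1) + q ^ (d + 1) * qInt q (k + 1) := by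
      rw [show k + d + 1 + 1 = d + 1 + (k + 1) by omega]
      simp only [qInt, Finset.sum_range_add _ (d + 1) (k + 1), pow_add _ (d + 1), Finset.mul_sum]
    rw [qBinom, qBinom, qBinom, if_pos (by omega), if_pos (by omega), if_pos (by omega),
      show k + d + 1 + 1 - (k + 1) = d + 1 by omega, show k + d + 1 - (k + 1) = d by omega,
      show k + d + 1 - k = d + 1 by omega]
    have := qFact_ne_zero hq
    have h1 := hq d
    have h2 := hq k
    simp only [qFact] at hsum ⊢
    rw [hsum]
    have h3 := this d
    have h4 := this k
    field_simp

lemma sum_pow_crossInv (hq : ∀ n, qInt q (n + 1) ≠ 0) {s n : ℕ} (hn : s ≤ n) :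
    ∀ {m : ℕ}, s ≤ m →
      ∑ S ∈ (Finset.powersetCard m (Finset.range n)).filter (Finset.range s ⊆ ·),
        q ^ crossInv S (Finset.range n \ S) = qBinom q (n - s) (m - s) := by
  induction n, hn using Nat.le_induction with
  | base =>
    intro m hm
    rcases hm.eq_or_lt with rfl | hlt
    · have h := Finset.powersetCard_self (Finset.range s)
      rw [Finset.card_range] at h
      rw [h, Finset.filter_singleton, if_pos (Finset.Subset.refl _),
        Finset.sum_singleton, qBinom_self hq]
      simp [crossInv]
    · rw [Finset.powersetCard_eq_empty.2 (by simpa using hlt), qBinom, if_neg (by omega)]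
      simp
  | succ n hn ih =>
    intro m hm
    rcases hm.eq_or_lt with rfl | hlt
    · have : (Finset.powersetCard s (Finset.range (n + 1))).filter (Finset.range s ⊆ ·) =
          {Finset.range s} := by
        ext S
        simp only [Finset.mem_filter, Finset.mem_powersetCard, Finset.mem_singleton]
        constructor
        · rintro ⟨⟨-, hc⟩, hS⟩
          exact (Finset.eq_of_subset_of_card_le hS (by simp [hc])).symm
        · rintro rfl
          refine ⟨⟨?_, by simp⟩, Finset.Subset.refl _⟩
          simp only [Finset.range_subset_range]
          omega
      rw [this, Finset.sum_singleton, Nat.sub_self, qBinom_zero_right hq]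
      suffices crossInv (Finset.range s) (Finset.range (n + 1) \ Finset.range s) = 0 by
        rw [this, pow_zero]
      refine Finset.sum_eq_zero fun x hx => ?_
      rw [Finset.card_eq_zero, Finset.filter_eq_empty_iff]
      intro y hy
      simp only [Finset.mem_sdiff, Finset.mem_range] at hx hy
      omega
    · obtain ⟨m, rfl⟩ : ∃ m', m = m' + 1 := ⟨m - 1, by omega⟩
      have hsn : n ∉ Finset.range s := by simpa using hn
      have hnn : n ∉ Finset.range n := by simp
      have hS : ∀ {j S}, S ∈ Finset.powersetCard j (Finset.range n) →
          n ∉ S ∧ S ⊆ Finset.range n ∧ S.card = j := fun h => by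
        rw [Finset.mem_powersetCard] at h
        exact ⟨fun hn => hnn (h.1 hn), h⟩
      rw [Finset.range_add_one, Finset.powersetCard_succ_insert hnn, Finset.filter_union,
        Finset.sum_union, Finset.filter_image, Finset.sum_image]
      · simp only [Finset.subset_insert_iff_of_notMem hsn]
        rw [show n + 1 - s = n - s + 1 by omega, show m + 1 - s = m - s + 1 by omega,
          qBinom_succ_succ hq, ← ih (show s ≤ m by omega), Finset.mul_sum,
          show m - s + 1 = m + 1 - s by omega, ← ih (show s ≤ m + 1 by omega)]
        congr 1
        · refine Finset.sum_congr rfl fun S h => ?_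
          obtain ⟨hnS, hS, -⟩ := hS (Finset.mem_filter.1 h).1
          congr 1
          refine Finset.sum_congr rfl fun x hx => ?_
          have := Finset.mem_range.1 (hS hx)
          rw [Finset.insert_sdiff_of_notMem _ hnS, Finset.filter_insert, if_neg (by omega)]
        · refine Finset.sum_congr rfl fun S h => ?_
          obtain ⟨hnS, hS, hc⟩ := hS (Finset.mem_filter.1 h).1
          have hsd : insert n (Finset.range n) \ insert n S = Finset.range n \ S := by
            rw [Finset.insert_sdiff_insert, Finset.sdiff_insert_of_notMem hnn]
          rw [← pow_add, hsd]
          congr 1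
          rw [crossInv, Finset.sum_insert hnS, ← crossInv]
          congr 1
          rw [Finset.filter_true_of_mem, Finset.card_sdiff_of_subset hS, hc, Finset.card_range]
          · omega
          · intro y hy
            simpa using (Finset.mem_sdiff.1 hy).1
      · intro S h T h' he
        have h1 := (hS (Finset.mem_filter.1 h).1).1
        have h2 := (hS (Finset.mem_filter.1 h').1).1
        rw [← Finset.erase_insert h1, ← Finset.erase_insert h2, he]
      · rw [Finset.disjoint_left]
        intro S h h'
        obtain ⟨T, -, rfl⟩ := Finset.mem_image.1 (Finset.mem_filter.1 h').1
        exact (hS (Finset.mem_filter.1 h).1).1 (Finset.mem_insert_self _ _)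

end QBinomial

section OrderingSum

variable {K : Type} [Field K] {q : K} {F G : List ℕ → K}

/-- Splitting the orderings of `{0, …, n-1}` into their first `m` and last `n - m` entries. -/
lemma sum_take_drop (hq : ∀ n, qInt q (n + 1) ≠ 0) (hF : OrderInvariant F)
    (hG : OrderInvariant G) {m n : ℕ} (hm : m ≤ n) :
    ∑ l ∈ orderings (Finset.range n), q ^ listInv l * (F (l.take m) * G (l.drop m)) =
      qBinom q n m * orderingSum q F (Finset.range m) *
        orderingSum q G (Finset.range (n - m)) := by
  have hsum := sum_pow_crossInv hq (Nat.zero_le n) (Nat.zero_le m)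
  simp only [Finset.range_zero, Finset.empty_subset, Finset.filter_true, Nat.sub_zero] at hsum
  rw [sum_orderings_append (by simpa using hm), ← hsum, Finset.sum_mul, Finset.sum_mul]
  refine Finset.sum_congr rfl fun S hS => ?_
  obtain ⟨hS, hc⟩ := Finset.mem_powersetCard.1 hS
  rw [orderingSum_eq_of_card hF (show (Finset.range m).card = S.card by simp [hc]),
    orderingSum_eq_of_card hG
      (show (Finset.range (n - m)).card = (Finset.range n \ S).card by
        simp [Finset.card_sdiff_of_subset hS, hc]),
    mul_assoc, orderingSum, orderingSum, Finset.sum_mul_sum, Finset.mul_sum]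
  refine Finset.sum_congr rfl fun u hu => ?_
  rw [Finset.mul_sum]
  refine Finset.sum_congr rfl fun v hv => ?_
  have hlen := length_of_mem_orderings hu
  rw [listInv_append_of_mem_orderings hu hv, ← hc, ← hlen, List.take_left, List.drop_left]
  ring

lemma sum_perm_eq {n : ℕ} (F : List ℕ → K) :
    ∑ σ : Equiv.Perm (Fin n), F (List.ofFn fun i => (σ i : ℕ)) =
      ∑ l ∈ orderings (Finset.range n), F l := by
  refine Finset.sum_bij (fun σ _ => List.ofFn fun i => (σ i : ℕ)) ?_ ?_ ?_ (fun _ _ => rfl)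
  · intro σ _
    refine mem_orderings.2 ⟨List.nodup_ofFn.2 (Fin.val_injective.comp σ.injective), ?_⟩
    ext x
    simp only [List.mem_toFinset, List.mem_ofFn, Finset.mem_range]
    exact ⟨fun ⟨i, hi⟩ => hi ▸ (σ i).2, fun h => ⟨σ.symm ⟨x, h⟩, by simp⟩⟩
  · intro σ _ τ _ h
    ext i
    exact congrFun (List.ofFn_injective h) i
  · intro l hl
    have hlen := length_of_mem_orderings hl
    rw [Finset.card_range] at hlen
    obtain ⟨hn, hr⟩ := mem_orderings.1 hl
    have hlt : ∀ i : Fin n, l[i] < n := fun i => by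
      rw [← Finset.mem_range, ← hr]
      simp
    let f : Fin n → Fin n := fun i => ⟨l[i], hlt i⟩
    have hf : Function.Injective f := fun i j h => by
      have : l[(i : ℕ)] = l[(j : ℕ)] := congrArg Fin.val h
      exact Fin.ext ((hn.getElem_inj_iff).1 this)
    refine ⟨Equiv.ofBijective f (Finite.injective_iff_bijective.1 hf), Finset.mem_univ _, ?_⟩
    refine List.ext_getElem (by simp [hlen]) fun i h h' => ?_
    simp [f]

end OrderingSum

section Weights

variable {p k : ℕ} {A : Fin k → Equiv.Perm (Fin p)} {K : Type} [Field K] {q z : K}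

lemma avoids_cons {x : ℕ} {t : List ℕ} :
    Avoids A (x :: t) ↔ (∀ i, ¬ PrefixMatch (A i) (x :: t)) ∧ Avoids A t := by
  constructor
  · exact fun h => ⟨fun i => h 0 i, fun d i => h (d + 1) i⟩
  · rintro ⟨h, h'⟩ (_ | d) i
    · exact h i
    · exact h' d i

lemma avoidWeight_invariant : OrderInvariant (avoidWeight A z) := by
  intro f l hf
  have h : Avoids A (l.map f) ↔ Avoids A l := by
    refine forall_congr' fun d => forall_congr' fun i => not_congr ?_
    rw [← List.map_drop]
    exact prefixMatch_map (hf.mono fun x hx => List.mem_of_mem_drop hx)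
  simp only [avoidWeight, List.map_eq_nil_iff, h, listDes_map hf]

lemma orderingSum_avoidWeight (hp : 0 < p) (n : ℕ) :
    orderingSum q (avoidWeight A z) (Finset.range n) = INMF A n q z := by
  rw [orderingSum, ← sum_perm_eq (fun l => q ^ listInv l * avoidWeight A z l), INMF]
  split_ifs with hn
  · subst hn
    simp [avoidWeight, listInv]
  · rw [Finset.sum_filter]
    refine Finset.sum_congr rfl fun σ _ => ?_
    have hne : (List.ofFn fun i => (σ i : ℕ)) ≠ [] := by simpa using hn
    have hav : Avoids A (List.ofFn fun i => (σ i : ℕ)) ↔ ∀ i, mch (A i) σ = 0 := by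
      rw [Avoids, forall_comm]
      refine forall_congr' fun i => ?_
      rw [mch_eq_card (w := List.ofFn fun i => (σ i : ℕ)) hp (by simp) (by simp),
        Finset.card_eq_zero, Finset.filter_eq_empty_iff]
      refine forall_congr' fun d => ⟨fun h _ => h, fun h hd => h ?_ hd⟩
      have := hd.1
      simp only [List.length_drop, List.length_ofFn] at this
      exact Finset.mem_range.2 (by omega)
    rw [avoidWeight, if_neg hne, hav]
    split_ifs
    · rw [listDes_ofFn, listInv_ofFn, mul_comm]
      rfl
    · simp

lemma blockWeight_invariant : OrderInvariant (blockWeight A z) := by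
  intro f l
  induction hl : l.length using Nat.strong_induction_on generalizing l with
  | _ n ih =>
    subst hl
    intro hf
    match l with
    | [] => rfl
    | [_] => simp [blockWeight]
    | x :: y :: t =>
      have h1 := ih (y :: t).length (by simp) (y :: t) rfl
        (hf.mono fun z hz => List.mem_cons_of_mem _ hz)
      have h2 := ih ((y :: t).drop (p - 2)).length
        (by simp only [List.length_drop, List.length_cons]; omega) ((y :: t).drop (p - 2)) rfl
        (hf.mono fun z hz => List.mem_cons_of_mem _ (List.mem_of_mem_drop hz))
      have h3 := fun i => prefixMatch_map (τ := A i) hf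
      rw [List.map_drop] at h2
      simp only [List.map_cons] at h1 h2 h3 ⊢
      simp only [blockWeight, h1, h2, h3, hf.lt_iff_lt (show x ∈ {z | z ∈ x :: y :: t} by simp)
        (show y ∈ {z | z ∈ x :: y :: t} by simp)]

lemma lt_of_blockWeight_ne_zero (hp : 2 ≤ p) (hstart : ∀ i a, A i ⟨0, by omega⟩ ≤ A i a)
    {x : ℕ} {t : List ℕ} (h : blockWeight A z (x :: t) ≠ 0) : ∀ y ∈ t, x < y := by
  induction hl : t.length using Nat.strong_induction_on generalizing x t with
  | _ n ih =>
    subst hl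
    match t with
    | [] => simp
    | y :: t =>
      rw [blockWeight] at h
      by_cases h1 : x < y ∧ blockWeight A z (y :: t) ≠ 0
      · have := ih t.length (by simp) h1.2 rfl
        intro w hw
        rcases List.mem_cons.1 hw with rfl | hw
        · exact h1.1
        · exact h1.1.trans (this w hw)
      · have h2 : ∃ i, PrefixMatch (A i) (x :: y :: t) ∧
            blockWeight A z ((y :: t).drop (p - 2)) ≠ 0 := by
          by_contra! hcon
          refine h ?_
          rw [Finset.sum_eq_zero, sub_zero]
          · split_ifs with hxy
            · rw [not_not.1 fun h0 => h1 ⟨hxy, h0⟩, mul_zero]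
            · rfl
          · intro i _
            split_ifs with hm
            · rw [hcon i hm, mul_zero]
            · rfl
        obtain ⟨i, ⟨hlen, hm⟩, hb⟩ := h2
        have hfirst : ∀ j (hj : j < (y :: t).length), j < p - 1 → x < (y :: t)[j] := by
          intro j hj hjp
          have := (hm ⟨0, by omega⟩ ⟨j + 1, by omega⟩).1
            (lt_of_le_of_ne (hstart i _) fun h => by simpa using (A i).injective h)
          simpa using this
        simp only [List.length_cons] at hlen
        rw [List.drop_eq_getElem_cons (show p - 2 < (y :: t).length by simp; omega)] at hb
        have hrest := ih _ (by simp only [List.length_drop, List.length_cons]; omega) hb rfl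
        have hlast := hfirst (p - 2) (by simp; omega) (by omega)
        intro w hw
        obtain ⟨j, hj, rfl⟩ := List.mem_iff_getElem.1 hw
        rcases lt_or_ge j (p - 1) with hjp | hjp
        · exact hfirst j hj hjp
        · refine hlast.trans (hrest _ ?_)
          rw [List.mem_iff_getElem]
          refine ⟨j - (p - 1), by simp at hj ⊢; omega, ?_⟩
          rw [List.getElem_drop]
          congr 1
          omega

end Weights
lemma listDes_eq_take_add_drop {m : ℕ} {l : List ℕ} (hm : m < l.length) :
    listDes l = listDes (l.take (m + 1)) + listDes (l.drop m) := by
  induction m generalizing l with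
  | zero =>
    match l, hm with
    | x :: t, _ => simp [listDes]
  | succ m ih =>
    match l, hm with
    | x :: y :: t, hm =>
      have := ih (l := y :: t) (by simpa using hm)
      simp only [List.take_succ_cons, List.drop_succ_cons, listDes] at this ⊢
      omega

lemma listDes_of_prefixMatch {p : ℕ} {τ : Equiv.Perm (Fin p)} {u : List ℕ} (hu : u.length = p)
    (h : PrefixMatch τ u) : listDes u = des τ := by
  subst hu
  obtain ⟨_, h⟩ := h
  conv_lhs => rw [← List.ofFn_getElem (xs := u), listDes_ofFn]
  simp only [des, h]

lemma listInv_of_prefixMatch {p : ℕ} {τ : Equiv.Perm (Fin p)} {u : List ℕ} (hu : u.length = p)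
    (h : PrefixMatch τ u) : listInv u = inv τ := by
  subst hu
  obtain ⟨_, h⟩ := h
  conv_lhs => rw [← List.ofFn_getElem (xs := u), listInv_ofFn]
  simp only [inv, h]

section PointwiseIdentity

variable {p k : ℕ} {A : Fin k → Equiv.Perm (Fin p)} {K : Type} [Field K] {z : K}

lemma avoidWeight_of_ne_nil {l : List ℕ} (hl : l ≠ []) :
    avoidWeight A z l = if Avoids A l then z ^ (listDes l + 1) else 0 :=
  if_neg hl

lemma avoidWeight_cons_cons (hp : 2 ≤ p)
    (huniq : ∀ l : List ℕ, l.Nodup → ∀ i j, PrefixMatch (A i) l → PrefixMatch (A j) l → i = j)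
    (hover : ∀ l : List ℕ, l.Nodup → ∀ i j d, 1 ≤ d → d + 2 ≤ p → PrefixMatch (A i) l →
      ¬ PrefixMatch (A j) (l.drop d))
    {x y : ℕ} {t : List ℕ} (hl : (x :: y :: t).Nodup) :
    avoidWeight A z (x :: y :: t) =
      (if x < y then 1 else z) * avoidWeight A z (y :: t) -
        ∑ i, if PrefixMatch (A i) (x :: y :: t) then
          z ^ des (A i) * avoidWeight A z ((y :: t).drop (p - 2)) else 0 := by
  have hdes : z ^ (listDes (x :: y :: t) + 1) =
      (if x < y then 1 else z) * z ^ (listDes (y :: t) + 1) := by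
    have hxy : x ≠ y := by
      rintro rfl
      simp at hl
    rw [listDes]
    rcases hxy.lt_or_gt with h | h
    · rw [if_neg h.not_gt, if_pos h, zero_add, one_mul]
    · rw [if_pos h, if_neg h.not_gt]
      ring
  by_cases hm : ∃ i, PrefixMatch (A i) (x :: y :: t)
  · obtain ⟨i, hi⟩ := hm
    have hlen := hi.1
    simp only [List.length_cons] at hlen
    rw [Finset.sum_eq_single i (fun j _ hj => if_neg fun h => hj (huniq _ hl _ _ h hi))
      (by simp), if_pos hi]
    have h0 : avoidWeight A z (x :: y :: t) = 0 := by
      rw [avoidWeight, if_neg (by simp), avoids_cons, if_neg fun h => h.1 i hi]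
    have hav : Avoids A (y :: t) ↔ Avoids A ((y :: t).drop (p - 2)) := by
      constructor
      · intro h d j
        rw [List.drop_drop]
        exact h _ j
      · intro h d j hj
        rcases lt_or_ge d (p - 2) with hd | hd
        · exact hover _ hl i j (d + 1) (by omega) (by omega) hi hj
        · refine h (d - (p - 2)) j ?_
          rwa [List.drop_drop, Nat.add_sub_cancel' hd]
    have hd : listDes (x :: y :: t) = des (A i) + listDes ((y :: t).drop (p - 2)) := by
      rw [listDes_eq_take_add_drop (m := p - 1) (by rw [List.length_cons, List.length_cons]; omega),
        show p - 1 = p - 2 + 1 by omega, show p - 2 + 1 + 1 = p by omega, List.drop_succ_cons,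
        listDes_of_prefixMatch (by simp; omega) ((prefixMatch_take _ _).2 ⟨le_rfl, hi⟩)]
    have hne : (y :: t).drop (p - 2) ≠ [] := by
      simp only [ne_eq, List.drop_eq_nil_iff, List.length_cons]
      omega
    rw [h0, eq_comm, sub_eq_zero, avoidWeight_of_ne_nil (List.cons_ne_nil y t),
      avoidWeight_of_ne_nil hne, mul_ite, mul_ite, mul_zero, mul_zero, ← hdes, hd, add_assoc,
      pow_add]
    exact if_congr hav rfl rfl
  · push Not at hm
    rw [Finset.sum_eq_zero (fun i _ => if_neg (hm i)), sub_zero,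
      avoidWeight_of_ne_nil (List.cons_ne_nil x _), avoidWeight_of_ne_nil (List.cons_ne_nil y t),
      mul_ite, mul_zero, ← hdes]
    exact if_congr (avoids_cons.trans (and_iff_right hm)) rfl rfl

/-- Inclusion–exclusion over the ascents and matches at the head of a list. -/
lemma sum_blockWeight_mul_avoidWeight (hp : 2 ≤ p)
    (huniq : ∀ l : List ℕ, l.Nodup → ∀ i j, PrefixMatch (A i) l → PrefixMatch (A j) l → i = j)
    (hover : ∀ l : List ℕ, l.Nodup → ∀ i j d, 1 ≤ d → d + 2 ≤ p → PrefixMatch (A i) l →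
      ¬ PrefixMatch (A j) (l.drop d))
    {l : List ℕ} (hl : l.Nodup) (hne : l ≠ []) :
    z * ∑ m ∈ Finset.range l.length,
      blockWeight A z (l.take (m + 1)) * avoidWeight A z (l.drop (m + 1)) = avoidWeight A z l := by
  induction hlen : l.length using Nat.strong_induction_on generalizing l with
  | _ n ih =>
    subst hlen
    match l, hne with
    | [x], _ =>
      have : Avoids A [x] := fun d i h => by
        have := h.1
        simp at this
        omega
      simp [blockWeight, avoidWeight, this, listDes]
    | x :: y :: t, _ =>
      have htl : (y :: t).Nodup := hl.of_cons
      have h1 := ih (y :: t).length (by simp) htl (by simp) rfl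
      have h2 : ∀ i, PrefixMatch (A i) (x :: y :: t) →
          z * ∑ m ∈ Finset.range (y :: t).length,
            (if PrefixMatch (A i) (x :: y :: t.take m) then
              blockWeight A z (((y :: t).take (m + 1)).drop (p - 2)) else 0) *
                avoidWeight A z ((y :: t).drop (m + 1)) =
          avoidWeight A z ((y :: t).drop (p - 2)) := by
        intro i hi
        have hlen := hi.1
        simp only [List.length_cons] at hlen
        rw [← ih ((y :: t).drop (p - 2)).length
          (by simp only [List.length_drop, List.length_cons]; omega)
          (htl.sublist (List.drop_sublist _ _)) (by simp; omega) rfl]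
        have hr : (y :: t).length = p - 2 + ((y :: t).drop (p - 2)).length := by
          simp; omega
        rw [hr, Finset.sum_range_add, Finset.sum_eq_zero, zero_add]
        · congr 1
          refine Finset.sum_congr rfl fun m _ => ?_
          have hm : PrefixMatch (A i) (x :: y :: t.take (p - 2 + m)) := by
            have := (prefixMatch_take (x :: y :: t) (p + m)).2 ⟨by omega, hi⟩
            rwa [show p + m = p - 2 + m + 1 + 1 by omega] at this
          rw [if_pos hm, List.drop_take, List.drop_drop,
            show p - 2 + m + 1 - (p - 2) = m + 1 by omega, ← add_assoc]
        · intro m hm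
          have hm' : ¬ PrefixMatch (A i) (x :: y :: t.take m) := fun h => by
            have := h.1
            have hm := Finset.mem_range.1 hm
            simp at this
            omega
          rw [if_neg hm', zero_mul]
      obtain ⟨c, hc⟩ : ∃ c, c = 1 - z := ⟨_, rfl⟩
      rw [avoidWeight_cons_cons hp huniq hover hl, List.length_cons, Finset.sum_range_succ', mul_add]
      simp only [zero_add, List.take_succ_cons, List.drop_succ_cons, blockWeight, ← hc, List.take_zero,
        List.drop_zero, one_mul, sub_mul, Finset.sum_sub_distrib, mul_sub z, ite_mul, zero_mul,
        Finset.sum_mul] at h1 h2 ⊢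
      have h3 : z * ∑ m ∈ Finset.range (y :: t).length,
          (if x < y then c * blockWeight A z (y :: t.take m) *
            avoidWeight A z (t.drop m) else 0) =
          if x < y then c * avoidWeight A z (y :: t) else 0 := by
        split_ifs
        · simp only [← h1, Finset.mul_sum]
          exact Finset.sum_congr rfl fun m _ => by ring
        · simp
      have h4 : z * ∑ m ∈ Finset.range (y :: t).length, ∑ i,
          (if PrefixMatch (A i) (x :: y :: t.take m) then
            z ^ des (A i) * blockWeight A z ((y :: t.take m).drop (p - 2)) *
              avoidWeight A z (t.drop m) else 0) =
          ∑ i, if PrefixMatch (A i) (x :: y :: t) then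
            z ^ des (A i) * avoidWeight A z ((y :: t).drop (p - 2)) else 0 := by
        rw [Finset.sum_comm, Finset.mul_sum]
        refine Finset.sum_congr rfl fun i _ => ?_
        split_ifs with hi
        · rw [← h2 i hi]
          simp only [Finset.mul_sum]
          refine Finset.sum_congr rfl fun m _ => ?_
          split_ifs <;> ring
        · rw [Finset.sum_eq_zero, mul_zero]
          intro m _
          refine if_neg fun h => hi ?_
          exact ((prefixMatch_take (x :: y :: t) (m + 2)).1 h).2
      rw [h3, h4, hc]
      split_ifs <;> ring

end PointwiseIdentity

section BlockSum

variable {p : ℕ} {K : Type} [Field K] {q : K} {F : List ℕ → K}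

lemma prefixMatch_append {τ : Equiv.Perm (Fin p)} {u v : List ℕ} (hu : u.length = p) :
    PrefixMatch τ (u ++ v) ↔ PrefixMatch τ u := by
  have := prefixMatch_take (τ := τ) (u ++ v) u.length
  rw [List.take_left] at this
  rw [this, and_iff_right hu.ge]

lemma card_filter_lt_orderEmbOfFin {S : Finset ℕ} (hS : S.card = p) (j : Fin p) :
    (S.filter (· < S.orderEmbOfFin hS j)).card = j := by
  have : S.filter (· < S.orderEmbOfFin hS j) =
      (Finset.Iio j).map (S.orderEmbOfFin hS).toEmbedding := by
    ext x
    simp only [Finset.mem_filter, Finset.mem_map, Finset.mem_Iio, RelEmbedding.coe_toEmbedding]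
    constructor
    · rintro ⟨hx, hlt⟩
      rw [← Finset.mem_coe, ← Finset.range_orderEmbOfFin S hS] at hx
      obtain ⟨i, rfl⟩ := hx
      exact ⟨i, by simpa using hlt, rfl⟩
    · rintro ⟨i, hi, rfl⟩
      exact ⟨Finset.orderEmbOfFin_mem S hS i, by simpa using hi⟩
  rw [this, Finset.card_map, Fin.card_Iio]

/-- The ordering of `S` in the relative order of `τ`. -/
def orderingOfPerm (τ : Equiv.Perm (Fin p)) (S : Finset ℕ) (hS : S.card = p) : List ℕ :=
  List.ofFn fun a => S.orderEmbOfFin hS (τ a)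

lemma mem_orderings_and_prefixMatch_iff {τ : Equiv.Perm (Fin p)} {S : Finset ℕ}
    (hS : S.card = p) {u : List ℕ} :
    u ∈ orderings S ∧ PrefixMatch τ u ↔ u = orderingOfPerm τ S hS := by
  constructor
  · rintro ⟨hu, h, hm⟩
    have hlen := (length_of_mem_orderings hu).trans hS
    obtain ⟨-, hSu⟩ := mem_orderings.1 hu
    have := Finset.orderEmbOfFin_unique hS
      (f := fun a => u[(τ.symm a : ℕ)]'((τ.symm a).2.trans_le h))
      (fun a => by rw [← hSu]; simp)
      (fun a b hab => (hm _ _).1 (by simpa using hab))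
    refine List.ext_getElem (by simp [orderingOfPerm, hlen]) fun i h h' => ?_
    simp [orderingOfPerm, ← this]
  · rintro rfl
    refine ⟨mem_orderings.2 ⟨List.nodup_ofFn.2
      ((S.orderEmbOfFin hS).injective.comp τ.injective), ?_⟩,
      by simp [orderingOfPerm], fun a b => by simp [orderingOfPerm]⟩
    ext x
    rw [← Finset.mem_coe (s := S), ← Finset.range_orderEmbOfFin S hS]
    simp only [orderingOfPerm, List.mem_toFinset, List.mem_ofFn, Set.mem_range]
    exact ⟨fun ⟨a, ha⟩ => ⟨_, ha⟩, fun ⟨a, ha⟩ => ⟨τ.symm a, by simpa using ha⟩⟩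

lemma exists_cons_of_mem_orderings_insert (hF : ∀ x t, F (x :: t) ≠ 0 → ∀ y ∈ t, x < y)
    {x : ℕ} {Y : Finset ℕ} (hx : ∀ y ∈ Y, x < y) {l : List ℕ} (hl : l ∈ orderings (insert x Y))
    (h : F l ≠ 0) : ∃ v, l = x :: v := by
  have hS := (mem_orderings.1 hl).2
  have hxl : x ∈ l := by
    rw [← List.mem_toFinset, hS]
    exact Finset.mem_insert_self _ _
  match l with
  | [] => simp at hxl
  | w :: t =>
    have hw : w ∈ insert x Y := by rw [← hS]; simp
    rcases Finset.mem_insert.1 hw with rfl | hw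
    · exact ⟨t, rfl⟩
    · rcases List.mem_cons.1 hxl with rfl | hxt
      · exact ⟨t, rfl⟩
      · exact absurd (hx w hw) (hF w t h x hxt).not_gt

/-- The sum over the lists that start with a match of `τ` whose last entry heads a list in the
support of `F`. As `F` is supported on lists headed by their minimum, the `s` smallest values all
lie in the match, where `s` is the (1-based) last entry of `τ`. -/
lemma sum_prefixMatch (hq : ∀ n, qInt q (n + 1) ≠ 0) (hF : OrderInvariant F)
    (hFmin : ∀ x t, F (x :: t) ≠ 0 → ∀ y ∈ t, x < y) (τ : Equiv.Perm (Fin p)) (hp : 0 < p)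
    {s : ℕ} (hs : 0 < s) (hsp : s < p) (hlast : (τ ⟨p - 1, by omega⟩ : ℕ) = s - 1)
    {n : ℕ} :
    ∑ l ∈ orderings (Finset.range n),
        q ^ listInv l * (if PrefixMatch τ l then F (l.drop (p - 1)) else 0) =
      q ^ inv τ * qBinom q (n - s) (p - s) * orderingSum q F (Finset.range (n - (p - 1))) := by
  rcases lt_or_ge n p with hnp | hnp
  · rw [Finset.sum_eq_zero]
    · rw [qBinom, if_neg (by omega), mul_zero, zero_mul]
    · intro l hl
      have := length_of_mem_orderings hl
      rw [Finset.card_range] at this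
      rw [if_neg (fun h => by have := h.1; omega), mul_zero]
  rw [sum_orderings_append (m := p) (by simpa using hnp),
    ← sum_pow_crossInv hq (hsp.le.trans hnp) hsp.le, Finset.sum_filter, Finset.mul_sum, Finset.sum_mul]
  refine Finset.sum_congr rfl fun S hS => ?_
  obtain ⟨hS, hc⟩ := Finset.mem_powersetCard.1 hS
  let e := S.orderEmbOfFin hc
  let j : Fin p := ⟨s - 1, by omega⟩
  have hj : τ ⟨p - 1, by omega⟩ = j := Fin.ext hlast
  have hu := (mem_orderings_and_prefixMatch_iff (τ := τ) hc).2 rfl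
  have hulen : (orderingOfPerm τ S hc).length = p := by simp [orderingOfPerm]
  have hdrop : (orderingOfPerm τ S hc).drop (p - 1) = [e j] := by
    rw [List.drop_eq_getElem_cons (by omega), List.drop_eq_nil_of_le (by omega)]
    simp [orderingOfPerm, hj, e]
  have hcount := card_filter_lt_orderEmbOfFin hc j
  rw [Finset.sum_eq_single_of_mem _ hu.1]
  · have hterm : ∀ v ∈ orderings (Finset.range n \ S),
        q ^ listInv (orderingOfPerm τ S hc ++ v) *
          (if PrefixMatch τ (orderingOfPerm τ S hc ++ v) then
            F ((orderingOfPerm τ S hc ++ v).drop (p - 1)) else 0) =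
        q ^ inv τ * q ^ crossInv S (Finset.range n \ S) * (q ^ listInv v * F (e j :: v)) := by
      intro v hv
      rw [if_pos ((prefixMatch_append hulen).2 hu.2), listInv_append_of_mem_orderings hu.1 hv,
        listInv_of_prefixMatch hulen hu.2, List.drop_append_of_le_length (by omega), hdrop]
      simp only [List.cons_append, List.nil_append]
      ring
    rw [Finset.sum_congr rfl hterm, ← Finset.mul_sum]
    split_ifs with hsub
    · have hjs : e j = s - 1 := by
        have hmem : s - 1 ∈ (S : Set ℕ) := hsub (Finset.mem_range.2 (by omega))
        rw [← Finset.range_orderEmbOfFin S hc] at hmem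
        obtain ⟨i, hi⟩ := hmem
        have hcard := card_filter_lt_orderEmbOfFin hc i
        have : S.filter (· < s - 1) = Finset.range (s - 1) := by
          ext x
          simp only [Finset.mem_filter, Finset.mem_range, and_iff_right_iff_imp]
          exact fun hx => hsub (Finset.mem_range.2 (by omega))
        rw [hi, this, Finset.card_range] at hcard
        have : i = j := Fin.ext hcard.symm
        rw [← this, ← hi]
      have hmin : ∀ y ∈ Finset.range n \ S, e j < y := by
        intro y hy
        by_contra! hlt
        exact (Finset.mem_sdiff.1 hy).2 (hsub (Finset.mem_range.2 (by omega)))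
      have hcard : (insert (e j) (Finset.range n \ S)).card =
          (Finset.range (n - (p - 1))).card := by
        rw [Finset.card_insert_of_notMem fun h => (hmin _ h).false,
          Finset.card_sdiff_of_subset hS, hc, Finset.card_range, Finset.card_range]
        omega
      have hins := orderingSum_insert (q := q) hmin
        fun l hl h => exists_cons_of_mem_orderings_insert hFmin hmin hl h
      rw [← orderingSum_eq_of_card hF hcard, hins]
      rfl
    · rw [mul_zero, zero_mul, Finset.sum_eq_zero, mul_zero]
      intro v hv
      by_contra hne
      have hlt := hFmin _ _ (right_ne_zero_of_mul hne)
      have hsm : ∀ x, x < e j → x ∈ S := by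
        intro x hx
        by_contra hxS
        have hn := Finset.mem_range.1 (hS (S.orderEmbOfFin_mem hc j))
        have hxv : x ∈ v.toFinset := by
          rw [(mem_orderings.1 hv).2, Finset.mem_sdiff, Finset.mem_range]
          exact ⟨hx.trans hn, hxS⟩
        exact (hlt x (List.mem_toFinset.1 hxv)).not_gt hx
      have hfil : S.filter (· < e j) = Finset.range (e j) := by
        ext x
        simp only [Finset.mem_filter, Finset.mem_range, and_iff_right_iff_imp]
        exact hsm x
      rw [hfil, Finset.card_range] at hcount
      refine hsub fun x hx => ?_
      rw [Finset.mem_range] at hx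
      rcases Nat.lt_or_ge x (e j) with h | h
      · exact hsm x h
      · have : x = e j := by
          change e j = s - 1 at hcount
          omega
        exact this ▸ S.orderEmbOfFin_mem hc j
  · intro u hu' hne
    refine Finset.sum_eq_zero fun v _ => ?_
    rw [if_neg, mul_zero]
    rw [prefixMatch_append ((length_of_mem_orderings hu').trans hc)]
    exact fun h => hne ((mem_orderings_and_prefixMatch_iff hc).1 ⟨hu', h⟩)

variable {k : ℕ} {A : Fin k → Equiv.Perm (Fin p)} {z : K}

/-- `F` of the tail, on the lists headed by their strict minimum. -/
def minTail (F : List ℕ → K) (l : List ℕ) : K :=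
  if ∀ y ∈ l.tail, l.headD 0 < y then F l.tail else 0

lemma minTail_cons (F : List ℕ → K) (x : ℕ) (t : List ℕ) :
    minTail F (x :: t) = if ∀ y ∈ t, x < y then F t else 0 :=
  rfl

lemma orderingSum_minTail (hF : OrderInvariant F) (n : ℕ) :
    orderingSum q (minTail F) (Finset.range (n + 1)) = orderingSum q F (Finset.range n) := by
  have hr : Finset.range (n + 1) = insert 0 (Finset.Ico 1 (n + 1)) := by
    ext x
    simp only [Finset.mem_range, Finset.mem_insert, Finset.mem_Ico]
    omega
  have hmin : ∀ y ∈ Finset.Ico 1 (n + 1), 0 < y := fun y hy => (Finset.mem_Ico.1 hy).1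
  rw [hr, orderingSum_insert (F := minTail F) hmin fun l hl h =>
      exists_cons_of_mem_orderings_insert (F := minTail F)
        (fun x t hx => (ite_ne_right_iff.1 hx).1) hmin hl h,
    orderingSum_eq_of_card (X := Finset.range n) (Y := Finset.Ico 1 (n + 1)) hF (by simp)]
  refine Finset.sum_congr rfl fun v hv => ?_
  have : minTail F (0 :: v) = F v := by
    rw [minTail_cons]
    refine if_pos fun y hy => hmin y ?_
    rw [← (mem_orderings.1 hv).2]
    simpa using hy
  change q ^ listInv v * minTail F (0 :: v) = _
  rw [this]

lemma orderingSum_blockWeight (hq : ∀ n, qInt q (n + 1) ≠ 0) (hp : 2 ≤ p)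
    (hstart : ∀ i a, A i ⟨0, by omega⟩ ≤ A i a) {S : Fin k → ℕ} (hS : ∀ i, 0 < S i)
    (hSp : ∀ i, S i < p) (hlast : ∀ i, (A i ⟨p - 1, by omega⟩ : ℕ) = S i - 1) {n : ℕ}
    (hn : 2 ≤ n) :
    orderingSum q (blockWeight A z) (Finset.range n) =
      (1 - z) * orderingSum q (blockWeight A z) (Finset.range (n - 1)) -
        (∑ i, z ^ des (A i) * q ^ inv (A i) * qBinom q (n - S i) (p - S i)) *
          orderingSum q (blockWeight A z) (Finset.range (n - (p - 1))) := by
  have hstep : ∀ l ∈ orderings (Finset.range n), q ^ listInv l * blockWeight A z l =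
      (1 - z) * (q ^ listInv l * minTail (blockWeight A z) l) -
      ∑ i, z ^ des (A i) * (q ^ listInv l *
        if PrefixMatch (A i) l then blockWeight A z (l.drop (p - 1)) else 0) := by
    intro l hl
    have hlen := length_of_mem_orderings hl
    rw [Finset.card_range] at hlen
    match l with
    | [] => simp at hlen; omega
    | [_] => simp at hlen; omega
    | x :: y :: t =>
      have hasc : minTail (blockWeight A z) (x :: y :: t) =
          if x < y then blockWeight A z (y :: t) else 0 := by
        rw [minTail_cons]
        by_cases hb : blockWeight A z (y :: t) = 0
        · simp [hb]
        · refine if_congr ⟨fun h => h y (by simp), fun h w hw => ?_⟩ rfl rfl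
          rcases List.mem_cons.1 hw with rfl | hw
          · exact h
          · exact h.trans (lt_of_blockWeight_ne_zero hp hstart hb w hw)
      simp only [hasc, blockWeight, mul_sub, Finset.mul_sum,
        show p - 1 = p - 2 + 1 by omega, List.drop_succ_cons]
      congr 1
      · split_ifs <;> ring
      · refine Finset.sum_congr rfl fun i _ => ?_
        split_ifs <;> ring
  obtain ⟨n, rfl⟩ : ∃ m, n = m + 1 := ⟨n - 1, by omega⟩
  rw [orderingSum, Finset.sum_congr rfl hstep, Finset.sum_sub_distrib, ← Finset.mul_sum,
    Finset.sum_comm, Finset.sum_mul]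
  congr 1
  · rw [← orderingSum, orderingSum_minTail blockWeight_invariant, Nat.add_sub_cancel]
  · refine Finset.sum_congr rfl fun i _ => ?_
    rw [← Finset.mul_sum, sum_prefixMatch hq blockWeight_invariant
      (fun x t h => lt_of_blockWeight_ne_zero hp hstart h) (A i) (by omega) (hS i) (hSp i)
      (hlast i)]
    ring

end BlockSum

lemma qInt_pW_succ_ne_zero (n : ℕ) : qInt pW (n + 1) ≠ 0 := by
  have h : qInt pW (n + 1) = algebraMap (MvPolynomial (Fin 2) ℚ) K2
      (∑ i ∈ Finset.range (n + 1), MvPolynomial.X 0 ^ i) := by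
    simp [qInt, pW]
  rw [h, Ne, map_eq_zero_iff _ (IsFractionRing.injective (MvPolynomial (Fin 2) ℚ) K2)]
  intro h0
  have := congrArg (MvPolynomial.eval fun _ => (1 : ℚ)) h0
  simp only [map_sum, map_pow, MvPolynomial.eval_X, one_pow, Finset.sum_const, Finset.card_range,
    nsmul_eq_mul, mul_one, map_zero] at this
  exact Nat.cast_ne_zero.2 n.succ_ne_zero this

/-- Theorem: let `Γ = {A 0, …, A (k-1)}` be `k` distinct minimal overlapping
permutations in `S_p` (`p ≥ 3`), all starting with `1` and pairwise mutually minimal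
overlapping, with last elements `S i` satisfying `2 ≤ S i < p`.  If `IU : ℕ → ℚ(q,z)`
satisfies `IU 0 = 1` and `Σ_{k=0}^n [n choose k]_q IU_k INM_{Γ,n-k} = 0` for `n ≥ 1`,
then `IU 1 = -z` and, for all `n ≥ 2`,
`IU n = (1-z) IU (n-1) - Σ_i z^{des(A i)} q^{inv(A i)} [n-S i choose p-S i]_q IU (n-(p-1))`.
Here `q = X 0` and `z = X 1` in `ℚ(q,z)`. -/
theorem stmt12 {p : ℕ} (hp : 3 ≤ p) (k : ℕ) (hk : 1 ≤ k)
    (A : Fin k → Equiv.Perm (Fin p)) (hAinj : Function.Injective A)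
    (hmo : ∀ i : Fin k, MinOverlapping (A i))
    (hstart : ∀ i : Fin k, A i ⟨0, by omega⟩ = ⟨0, by omega⟩)
    (hmut : ∀ i i' : Fin k, i < i' → MutuallyMinOverlapping (A i) (A i'))
    (S : Fin k → ℕ) (hS2 : ∀ i, 2 ≤ S i) (hSp : ∀ i, S i < p)
    (hlastA : ∀ i : Fin k,
      A i ⟨p - 1, by omega⟩ = ⟨S i - 1, lt_of_le_of_lt (Nat.sub_le (S i) 1) (hSp i)⟩)
    (IU : ℕ → K2) (hIU0 : IU 0 = 1)
    (hIUdef : ∀ n : ℕ, 1 ≤ n →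
      ∑ m ∈ Finset.range (n + 1), qBinom pW n m * IU m * INMF A (n - m) pW qW = 0) :
    IU 1 = -qW ∧
    ∀ n : ℕ, 2 ≤ n →
      IU n = (1 - qW) * IU (n - 1) -
        (∑ i : Fin k,
          qW ^ des (A i) * pW ^ inv (A i) * qBinom pW (n - S i) (p - S i)) *
          IU (n - (p - 1)) := by
  have hq := qInt_pW_succ_ne_zero
  have hmut' : ∀ i j, i ≠ j → IsLeast {n : ℕ | ∃ σ : Equiv.Perm (Fin n),
      1 ≤ mch (A i) σ ∧ 1 ≤ mch (A j) σ} (2 * p - 1) := by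
    intro i j hij
    rcases hij.lt_or_gt with h | h
    · exact (hmut i j h).2.2
    · simpa only [and_comm] using (hmut j i h).2.2
  have huniq : ∀ l : List ℕ, l.Nodup → ∀ i j, PrefixMatch (A i) l → PrefixMatch (A j) l →
      i = j := by
    intro l hl i j hi hj
    by_contra hij
    exact not_prefixMatch_drop_of_mutually (hmut' i j hij) hl (d := 0) (d' := 0)
      (by omega) (by omega) (Or.inl rfl) hi hj
  have hover : ∀ l : List ℕ, l.Nodup → ∀ i j d, 1 ≤ d → d + 2 ≤ p → PrefixMatch (A i) l →
      ¬ PrefixMatch (A j) (l.drop d) := by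
    intro l hl i j d hd hdp hi
    by_cases hij : i = j
    · subst hij
      exact not_prefixMatch_drop (hmo i) hl hi hd hdp
    · exact not_prefixMatch_drop_of_mutually (hmut' i j hij) hl (d := 0) (by omega) hdp
        (Or.inl rfl) hi
  let B : ℕ → K2 := fun n => orderingSum pW (blockWeight A qW) (Finset.range n)
  have hINM : ∀ n, 1 ≤ n → INMF A n pW qW =
      ∑ m ∈ Finset.range n, qBinom pW n (m + 1) * (qW * B (m + 1)) *
        INMF A (n - (m + 1)) pW qW := by
    intro n hn
    have hpoint : ∀ l ∈ orderings (Finset.range n), pW ^ listInv l * avoidWeight A qW l =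
        ∑ m ∈ Finset.range n, qW * (pW ^ listInv l *
          (blockWeight A qW (l.take (m + 1)) * avoidWeight A qW (l.drop (m + 1)))) := by
      intro l hl
      have hlen := length_of_mem_orderings hl
      rw [Finset.card_range] at hlen
      rw [← sum_blockWeight_mul_avoidWeight (by omega) huniq hover (mem_orderings.1 hl).1
        (List.ne_nil_of_length_pos (by omega)), hlen, Finset.mul_sum, Finset.mul_sum]
      exact Finset.sum_congr rfl fun m _ => by ring
    rw [← orderingSum_avoidWeight (by omega), orderingSum, Finset.sum_congr rfl hpoint,
      Finset.sum_comm]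
    refine Finset.sum_congr rfl fun m hm => ?_
    rw [← Finset.mul_sum, sum_take_drop hq blockWeight_invariant avoidWeight_invariant
      (by have := Finset.mem_range.1 hm; omega), orderingSum_avoidWeight (by omega)]
    ring
  have hIU : ∀ n, 1 ≤ n → IU n = -qW * B n := by
    intro n
    induction n using Nat.strong_induction_on with
    | _ n ih =>
      intro hn
      have h := hIUdef n hn
      obtain ⟨n, rfl⟩ : ∃ m, n = m + 1 := ⟨n - 1, by omega⟩
      rw [Finset.sum_range_succ', qBinom_zero_right hq, hIU0, Nat.sub_zero, hINM _ hn, one_mul,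
        one_mul, ← Finset.sum_add_distrib, Finset.sum_range_succ, Finset.sum_eq_zero, zero_add,
        qBinom_self hq, Nat.sub_self] at h
      · simp only [INMF, if_true] at h
        linear_combination h
      · intro m hm
        have := Finset.mem_range.1 hm
        rw [ih (m + 1) (by omega) (by omega)]
        ring
  have hB1 : B 1 = 1 := by
    have h1 : orderings (Finset.range 1) = {[0]} := by
      ext l
      rw [Finset.mem_singleton]
      constructor
      · intro hl
        obtain ⟨x, rfl⟩ := List.length_eq_one_iff.1 (length_of_mem_orderings hl)
        have hx := (mem_orderings.1 hl).2
        simpa using hx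
      · rintro rfl
        exact mem_orderings.2 (by simp)
    change orderingSum pW (blockWeight A qW) (Finset.range 1) = 1
    rw [orderingSum, h1, Finset.sum_singleton]
    simp [blockWeight, listInv]
  refine ⟨by rw [hIU 1 le_rfl, hB1, mul_one], fun n hn => ?_⟩
  have hB := orderingSum_blockWeight (z := qW) hq (by omega)
    (fun i a => by rw [hstart i]; exact Nat.zero_le _)
    (fun i => (by have := hS2 i; omega : 0 < S i)) hSp (fun i => by rw [hlastA i]) hn
  change B n = _ * B (n - 1) - _ * B (n - (p - 1)) at hB
  rw [hIU n (by omega), hIU (n - 1) (by omega), hB]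
  rcases lt_or_ge n p with hnp | hnp
  · rw [Finset.sum_eq_zero]
    · ring
    · intro i _
      have := hSp i
      rw [qBinom, if_neg (by omega), mul_zero]
  · rw [hIU (n - (p - 1)) (by omega)]
    ring

end CWilf
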